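/- arXiv:math/0610699 — 2 statements merged into one kernel-verified Lean document; each statement's English description precedes it below -/
import Mathlib

section
/- Let d be a positive square-free integer with d ≡ 7 (mod 8), K = ℚ(√−d), R = 𝓞_K, and let u ∈ ℍ(R) have norm η(u) = −1. Then u is a unit of ℍ(R) of infinite multiplicative order, i.e., uⁿ ≠ 1 for every positive integer n. -/
open Quaternion NumberField

/-- If `d ≡ 7 (mod 8)` then `-d` is a square in the ring of 2-adic integers. -/
theorem PadicInt.exists_sq_eq_neg_of_emod_eight {d : ℤ} (hd7 : d % 8 = 7) :
    ∃ s : ℤ_[2], s ^ 2 = -(d : ℤ_[2]) := by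
  have h1 : ‖(1 + d : ℤ_[2])‖ ≤ (2 : ℝ) ^ (-(3 : ℕ) : ℤ) := by
    have := (PadicInt.norm_int_le_pow_iff_dvd (p := 2) (k := 1 + d) (n := 3)).2 (by norm_num; omega)
    simpa using this
  have h2 : ‖(2 : ℤ_[2])‖ = 2⁻¹ := by
    have := PadicInt.norm_p (p := 2)
    simpa using this
  have h : ‖Polynomial.aeval (1 : ℤ_[2]) (Polynomial.X ^ 2 + Polynomial.C (d : ℤ_[2]))‖ <
      ‖Polynomial.aeval (1 : ℤ_[2]) (Polynomial.derivative
        (Polynomial.X ^ 2 + Polynomial.C (d : ℤ_[2])))‖ ^ 2 := by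
    have e : Polynomial.aeval (1 : ℤ_[2]) (Polynomial.derivative
        (Polynomial.X ^ 2 + Polynomial.C (d : ℤ_[2]))) = 2 := by
      simp [Polynomial.aeval_def, one_add_one_eq_two]
    have e' : Polynomial.aeval (1 : ℤ_[2]) (Polynomial.X ^ 2 + Polynomial.C (d : ℤ_[2])) =
        1 + d := by simp [Polynomial.aeval_def]
    rw [e, e', h2]
    exact h1.trans_lt (by norm_num)
  obtain ⟨s, hs, -⟩ := hensels_lemma h
  refine ⟨s, eq_neg_of_add_eq_zero_left ?_⟩
  simpa [Polynomial.aeval_def] using hs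

/-- A number field generated by a square root of `-d`, where `d ≡ 7 (mod 8)`, embeds in `ℚ_[2]`. -/
theorem nonempty_ringHom_padic_two {d : ℤ} (hd7 : d % 8 = 7) {K : Type*} [Field K]
    [CharZero K] {r : K} (hr : r ^ 2 = -(d : K)) (hgen : Algebra.adjoin ℚ {r} = ⊤) :
    Nonempty (K →+* ℚ_[2]) := by
  obtain ⟨s, hs⟩ := PadicInt.exists_sq_eq_neg_of_emod_eight hd7
  have hs' : (s : ℚ_[2]) ^ 2 = -(d : ℚ_[2]) := by exact_mod_cast congrArg Subtype.val hs
  have hmonic : (Polynomial.X ^ 2 + Polynomial.C (d : ℚ)).Monic := by monicity!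
  have hroot : Polynomial.aeval r (Polynomial.X ^ 2 + Polynomial.C (d : ℚ)) = 0 := by
    simp [hr]
  have hsplit : ((Polynomial.X ^ 2 + Polynomial.C (d : ℚ)).map (algebraMap ℚ ℚ_[2])).Splits := by
    have : (Polynomial.X ^ 2 + Polynomial.C (d : ℚ)).map (algebraMap ℚ ℚ_[2]) =
        (Polynomial.X - Polynomial.C (s : ℚ_[2])) * (Polynomial.X + Polynomial.C (s : ℚ_[2])) := by
      have hC : (Polynomial.C (s : ℚ_[2])) ^ 2 = -Polynomial.C (d : ℚ_[2]) := by
        rw [← Polynomial.C_pow, hs', Polynomial.C_neg]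
      simp only [Polynomial.map_add, Polynomial.map_pow, Polynomial.map_X, Polynomial.map_C,
        eq_ratCast, Rat.cast_intCast]
      linear_combination hC
    rw [this]
    exact (Polynomial.Splits.X_sub_C _).mul (Polynomial.Splits.X_add_C _)
  have htop : IntermediateField.adjoin ℚ {r} = ⊤ := by
    rw [eq_top_iff]
    intro x _
    exact IntermediateField.algebra_adjoin_le_adjoin ℚ {r} (hgen ▸ Algebra.mem_top)
  obtain ⟨f⟩ := IntermediateField.nonempty_algHom_of_adjoin_splits (K := ℚ_[2])
    (fun x hx => by
      rw [Set.mem_singleton_iff] at hx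
      subst hx
      exact ⟨⟨_, hmonic, hroot⟩, hsplit.of_dvd (Polynomial.map_ne_zero hmonic.ne_zero)
        (Polynomial.map_dvd _ (minpoly.dvd _ _ hroot))⟩) htop
  exact ⟨f.toRingHom⟩

/-- A `2`-adic embedding of a number field yields a ring homomorphism from its ring of integers
to `ZMod 8`. -/
theorem NumberField.RingOfIntegers.nonempty_ringHom_zmod_eight {K : Type*} [Field K]
    (f : K →+* ℚ_[2]) : Nonempty (𝓞 K →+* ZMod 8) := by
  have hint (x : 𝓞 K) : f x ∈ PadicInt.subring 2 := by
    have h : IsIntegral ℤ_[2] (f x) :=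
      (x.isIntegral_coe.map f.toIntAlgHom).tower_top
    obtain ⟨y, hy⟩ := IsIntegrallyClosed.isIntegral_iff.1 h
    rw [← hy]
    exact y.2
  let g : 𝓞 K →+* ℤ_[2] :=
    (f.comp (algebraMap (𝓞 K) K)).codRestrict (PadicInt.subring 2) hint
  exact ⟨(PadicInt.toZModPow 3).comp g⟩

theorem Quaternion.re_sq {R : Type*} [CommRing R] (w : ℍ[R]) :
    (w ^ 2).re = 2 * w.re ^ 2 - Quaternion.normSq w := by
  rw [Quaternion.normSq_def', pow_two w, Quaternion.re_mul]
  ring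

/-- A quaternion of norm one and odd real part whose order is a power of two has real part
`1` or `-1`. -/
theorem Quaternion.re_sq_eq_one_of_pow_two_pow_eq_one {R : Type*} [CommRing R] [IsDomain R]
    (h2 : (2 : R) ≠ 0) (hunit : ¬ IsUnit (2 : R)) (k : ℕ) (w : ℍ[R])
    (hn : Quaternion.normSq w = 1) (hodd : ∃ b, w.re = 2 * b + 1) (hw : w ^ 2 ^ k = 1) :
    w.re ^ 2 = 1 := by
  induction k generalizing w with
  | zero =>
    have : w = 1 := by simpa using hw
    simp [this]
  | succ k ih =>
    have hre := Quaternion.re_sq w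
    rw [hn] at hre
    have hsq := ih (w ^ 2) (by rw [map_pow, hn, one_pow])
      ⟨w.re ^ 2 - 1, by rw [hre]; ring⟩ (by rw [← pow_mul, ← pow_succ', hw])
    rw [hre] at hsq
    have hprod : (2 * 2) * (w.re ^ 2 * (w.re ^ 2 - 1)) = 0 := by linear_combination hsq
    rcases mul_eq_zero.1 ((mul_eq_zero.1 hprod).resolve_left (mul_ne_zero h2 h2)) with h | h
    · obtain ⟨b, hb⟩ := hodd
      rw [pow_eq_zero_iff two_ne_zero, hb] at h
      exact absurd (IsUnit.of_mul_eq_one (-b) (by linear_combination -h)) hunit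
    · exact sub_eq_zero.1 h

/-- A quaternion of norm `-1` over a domain mapping to `ZMod 8` has infinite order. -/
theorem Quaternion.pow_ne_one_of_normSq_eq_neg_one {R : Type*} [CommRing R] [IsDomain R]
    (h2 : (2 : R) ≠ 0) (φ : R →+* ZMod 8) {u : ℍ[R]} (hu : Quaternion.normSq u = -1)
    {n : ℕ} (hn : 0 < n) : u ^ n ≠ 1 := by
  intro hun
  obtain ⟨k, m, hm, rfl⟩ := Nat.exists_eq_two_pow_mul_odd hn.ne'
  have hunit : ¬ IsUnit (2 : R) := fun h => by
    have := h.map φ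
    rw [map_ofNat] at this
    revert this
    decide
  set v := u ^ m with hv
  have hvn : Quaternion.normSq v = -1 := by rw [hv, map_pow, hu, hm.neg_one_pow]
  have hvk : v ^ 2 ^ k = 1 := by rw [hv, ← pow_mul, mul_comm, hun]
  have hre := Quaternion.re_sq v
  rw [hvn] at hre
  have hsq := Quaternion.re_sq_eq_one_of_pow_two_pow_eq_one h2 hunit k (v ^ 2)
    (by rw [map_pow, hvn]; ring) ⟨v.re ^ 2, by rw [hre]; ring⟩
    (by rw [← pow_mul, mul_comm, pow_mul, hvk, one_pow])
  rw [hre] at hsq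
  have hprod : (2 * 2) * (v.re ^ 2 * (v.re ^ 2 + 1)) = 0 := by linear_combination hsq
  rcases mul_eq_zero.1 ((mul_eq_zero.1 hprod).resolve_left (mul_ne_zero h2 h2)) with h | h
  · rw [Quaternion.normSq_def', h] at hvn
    have := congrArg φ hvn
    simp only [map_add, map_pow, map_neg, map_one, map_zero] at this
    have key : ∀ a b c : ZMod 8, 0 + a ^ 2 + b ^ 2 + c ^ 2 ≠ -1 := by decide
    exact key _ _ _ this
  · have := congrArg φ h
    simp only [map_add, map_pow, map_one, map_zero] at this
    have key : ∀ a : ZMod 8, a ^ 2 + 1 ≠ 0 := by decide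
    exact key _ this

/-- Let `d > 0` be square-free with `d ≡ 7 (mod 8)`, `K = ℚ(√−d)`,
`R = 𝓞 K`, and let `u ∈ ℍ(R)` have norm `η(u) = −1`. Then `u` is a unit of `ℍ(R)` of
infinite multiplicative order, i.e. `uⁿ ≠ 1` for every positive integer `n`. -/
theorem quaternion_norm_neg_one_infinite_order
    (d : ℤ) (hd : 0 < d) (hsf : Squarefree d) (hd7 : d % 8 = 7)
    (K : Type) [Field K] [NumberField K]
    (rd : 𝓞 K) (hrd : rd ^ 2 = -(d : 𝓞 K))
    (hgen : Algebra.adjoin ℚ {(rd : K)} = ⊤)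
    (u : ℍ[𝓞 K]) (hu : Quaternion.normSq u = -1) :
    IsUnit u ∧ ∀ n : ℕ, 0 < n → u ^ n ≠ 1 := by
  refine ⟨?_, fun n hn => ?_⟩
  · have h : u * star u = -1 := by rw [Quaternion.self_mul_star, hu]; simp
    have h' : star u * u = -1 := by rw [Quaternion.star_mul_self, hu]; simp
    exact ⟨⟨u, -star u, by simp [h], by simp [h']⟩, rfl⟩
  · obtain ⟨f⟩ := nonempty_ringHom_padic_two hd7 (r := (rd : K))
      (by simpa using congrArg (algebraMap (𝓞 K) K) hrd) hgen
    obtain ⟨φ⟩ := NumberField.RingOfIntegers.nonempty_ringHom_zmod_eight f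
    exact Quaternion.pow_ne_one_of_normSq_eq_neg_one two_ne_zero φ hu hn
end

section
/- Let d be a positive square-free integer, K = ℚ(√−d), R = 𝓞_K, and let x, y be rational integers. If u = (x√−d)·i + y·j ∈ ℍ(R) is a unit of ℍ(R), then u is a torsion element; in fact u² = ±1, so u⁴ = 1. -/
open Quaternion NumberField

/-- A rational integer that is a unit in the ring of integers of a number field is a unit of `ℤ`. -/
theorem NumberField.RingOfIntegers.isUnit_intCast_iff (K : Type*) [Field K] [NumberField K]
    {n : ℤ} : IsUnit (n : 𝓞 K) ↔ IsUnit n := by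
  refine ⟨fun h => ?_, fun h => by simpa using h.map (algebraMap ℤ (𝓞 K))⟩
  have hpow := h.map (Algebra.norm ℤ)
  rw [← eq_intCast (algebraMap ℤ (𝓞 K)), Algebra.norm_algebraMap] at hpow
  exact (isUnit_pow_iff Module.finrank_pos.ne').mp hpow

/-- Let `d > 0` be square-free, `K = ℚ(√−d)`, `R = 𝓞 K`, and let
`x, y` be rational integers. If `u = (x√−d)·i + y·j ∈ ℍ(R)` is a unit of `ℍ(R)`,
then `u` is a torsion element; in fact `u² = ±1`, so `u⁴ = 1`. -/
theorem quaternion_unit_without_re_is_torsion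
    (d : ℤ) (hd : 0 < d) (hsf : Squarefree d)
    (K : Type) [Field K] [NumberField K]
    (rd : 𝓞 K) (hrd : rd ^ 2 = -(d : 𝓞 K))
    (hgen : Algebra.adjoin ℚ {(rd : K)} = ⊤)
    (x y : ℤ)
    (hu : IsUnit (⟨0, (x : 𝓞 K) * rd, (y : 𝓞 K), 0⟩ : ℍ[𝓞 K])) :
    IsOfFinOrder (⟨0, (x : 𝓞 K) * rd, (y : 𝓞 K), 0⟩ : ℍ[𝓞 K]) ∧
      ((⟨0, (x : 𝓞 K) * rd, (y : 𝓞 K), 0⟩ : ℍ[𝓞 K]) ^ 2 = 1 ∨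
        (⟨0, (x : 𝓞 K) * rd, (y : 𝓞 K), 0⟩ : ℍ[𝓞 K]) ^ 2 = -1) ∧
      (⟨0, (x : 𝓞 K) * rd, (y : 𝓞 K), 0⟩ : ℍ[𝓞 K]) ^ 4 = 1 := by
  set u : ℍ[𝓞 K] := ⟨0, (x : 𝓞 K) * rd, (y : 𝓞 K), 0⟩ with hu_def
  have hnorm : Quaternion.normSq u = ((y ^ 2 - d * x ^ 2 : ℤ) : 𝓞 K) := by
    rw [Quaternion.normSq_def', hu_def]
    push_cast
    linear_combination (x : 𝓞 K) ^ 2 * hrd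
  have hsq : u ^ 2 = -((Quaternion.normSq u : 𝓞 K) : ℍ[𝓞 K]) := by
    rw [← Quaternion.self_mul_star u, sq, Quaternion.star_eq_neg.mpr rfl, mul_neg, neg_neg]
  have hsq' : u ^ 2 = 1 ∨ u ^ 2 = -1 := by
    have hn : IsUnit (Quaternion.normSq u) := hu.map Quaternion.normSq
    rw [hnorm, NumberField.RingOfIntegers.isUnit_intCast_iff, Int.isUnit_iff] at hn
    rw [hsq, hnorm]
    rcases hn with h | h <;> simp [h]
  have hfour : u ^ 4 = 1 := by
    rw [show 4 = 2 * 2 from rfl, pow_mul]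
    rcases hsq' with h | h <;> simp [h]
  exact ⟨isOfFinOrder_iff_pow_eq_one.mpr ⟨4, by norm_num, hfour⟩, hsq', hfour⟩
end
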